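/- Let T¹ ∈ ℝ with T¹ ≠ 0, and consider on ℝ² the connection with constant Christoffel symbols Γ_{12}¹ = T¹, Γ_{21}¹ = −T¹, Γ_{22}¹ = 1, and all other Γ_{ij}^k = 0 (the model M₄⁶(T¹,0)). Then a smooth vector field X on ℝ² is an affine Killing vector field for this connection if and only if X lies in the ℝ-linear span of the four vector fields (1,0), (0,1), (x¹ + ½(x²)², 0), and (x², 0). -/

import Mathlib

open Real

/-- The partial derivative `∂f/∂x^i` of a function on `ℝ²` (points are `Fin 2 → ℝ`). -/
noncomputable def pd (f : (Fin 2 → ℝ) → ℝ) (i : Fin 2) (p : Fin 2 → ℝ) : ℝ :=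
  fderiv ℝ f p (Pi.single i 1)

/-- The affine Killing operator
`K^Γ_{ij}^k(v) = ∂_i∂_j v^k + v^l ∂_l Γ_{ij}^k − Γ_{ij}^l ∂_l v^k + Γ_{il}^k ∂_j v^l + Γ_{lj}^k ∂_i v^l`
(summation over `l`). -/
noncomputable def killingOp (Γ : Fin 2 → Fin 2 → Fin 2 → (Fin 2 → ℝ) → ℝ)
    (v : Fin 2 → (Fin 2 → ℝ) → ℝ) (i j k : Fin 2) (p : Fin 2 → ℝ) : ℝ :=
  pd (fun q => pd (v k) j q) i p
    + (∑ l : Fin 2, v l p * pd (Γ i j k) l p)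
    - (∑ l : Fin 2, Γ i j l p * pd (v k) l p)
    + (∑ l : Fin 2, Γ i l k p * pd (v l) j p)
    + (∑ l : Fin 2, Γ l j k p * pd (v l) i p)

/-- `v` is an affine Killing vector field for the connection `Γ` on `U`:
all eight affine Killing equations hold on `U`. -/
def IsAffineKilling (U : Set (Fin 2 → ℝ))
    (Γ : Fin 2 → Fin 2 → Fin 2 → (Fin 2 → ℝ) → ℝ)
    (v : Fin 2 → (Fin 2 → ℝ) → ℝ) : Prop :=
  ∀ i j k : Fin 2, ∀ p ∈ U, killingOp Γ v i j k p = 0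

theorem pd_contDiff {f : (Fin 2 → ℝ) → ℝ} (hf : ContDiff ℝ (⊤ : ℕ∞) f) (i : Fin 2) :
    ContDiff ℝ (⊤ : ℕ∞) (fun p => pd f i p) := by
  unfold pd
  exact (hf.fderiv_right (m := (⊤ : ℕ∞)) (by simp)).clm_apply contDiff_const

theorem pd_pd_eq {f : (Fin 2 → ℝ) → ℝ} (hf : ContDiff ℝ (⊤ : ℕ∞) f) (i j : Fin 2)
    (p : Fin 2 → ℝ) :
    pd (fun q => pd f j q) i p
      = fderiv ℝ (fderiv ℝ f) p (Pi.single i 1) (Pi.single j 1) := by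
  have h : DifferentiableAt ℝ (fderiv ℝ f) p :=
    (hf.fderiv_right (m := (⊤ : ℕ∞)) (by simp)).differentiable (by simp) p
  unfold pd
  rw [fderiv_clm_apply h (differentiableAt_const _)]
  simp

theorem pd_comm {f : (Fin 2 → ℝ) → ℝ} (hf : ContDiff ℝ (⊤ : ℕ∞) f) (i j : Fin 2)
    (p : Fin 2 → ℝ) :
    pd (fun q => pd f j q) i p = pd (fun q => pd f i q) j p := by
  rw [pd_pd_eq hf, pd_pd_eq hf]
  exact (hf.contDiffAt.isSymmSndFDerivAt
    (by simpa using WithTop.coe_le_coe.2 (le_top : (2 : ℕ∞) ≤ ⊤))) _ _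

theorem eq_const_of_pd_eq_zero {f : (Fin 2 → ℝ) → ℝ} (hf : Differentiable ℝ f)
    (h : ∀ i p, pd f i p = 0) (p : Fin 2 → ℝ) : f p = f 0 := by
  refine is_const_of_fderiv_eq_zero hf (fun q => ?_) p 0
  apply ContinuousLinearMap.coe_injective
  refine LinearMap.pi_ext' fun i => LinearMap.ext_ring ?_
  simpa [pd] using h i q

/-- A quadratic function on `ℝ²` whose only second-order term is in the second coordinate. -/
def quad (a b c d : ℝ) (p : Fin 2 → ℝ) : ℝ := a + b * p 0 + c * p 1 + d * p 1 ^ 2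

theorem hasFDerivAt_quad (a b c d : ℝ) (p : Fin 2 → ℝ) :
    HasFDerivAt (quad a b c d)
      (b • ContinuousLinearMap.proj (R := ℝ) (φ := fun _ : Fin 2 => ℝ) 0
        + (c + 2 * d * p 1) • ContinuousLinearMap.proj (R := ℝ) (φ := fun _ : Fin 2 => ℝ) 1) p := by
  have h0 := hasFDerivAt_apply (𝕜 := ℝ) (0 : Fin 2) p
  have h1 := hasFDerivAt_apply (𝕜 := ℝ) (1 : Fin 2) p
  refine ((((h0.const_mul b).const_add a).add (h1.const_mul c)).add
    ((h1.pow 2).const_mul d)).congr_fderiv ?_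
  ext i
  simp
  ring

theorem pd_quad_zero (a b c d : ℝ) (p : Fin 2 → ℝ) : pd (quad a b c d) 0 p = b := by
  simp [pd, (hasFDerivAt_quad a b c d p).fderiv]

theorem pd_quad_one (a b c d : ℝ) (p : Fin 2 → ℝ) :
    pd (quad a b c d) 1 p = c + 2 * d * p 1 := by
  simp [pd, (hasFDerivAt_quad a b c d p).fderiv]

theorem pd_const (c : ℝ) (i : Fin 2) (p : Fin 2 → ℝ) : pd (fun _ => c) i p = 0 := by
  simp [pd]

theorem eq_quad_of_pd_eq {f : (Fin 2 → ℝ) → ℝ} (hf : Differentiable ℝ f) (b c d : ℝ)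
    (h0 : ∀ p, pd f 0 p = b) (h1 : ∀ p, pd f 1 p = c + 2 * d * p 1) (p : Fin 2 → ℝ) :
    f p = quad (f 0) b c d p := by
  have hq : Differentiable ℝ (quad 0 b c d) :=
    fun q => (hasFDerivAt_quad 0 b c d q).differentiableAt
  have key : ∀ i q, pd (fun r => f r - quad 0 b c d r) i q = 0 := by
    intro i q
    have hsub : pd (fun r => f r - quad 0 b c d r) i q = pd f i q - pd (quad 0 b c d) i q := by
      unfold pd
      rw [fderiv_fun_sub (hf q) (hq q)]
      rfl
    rw [hsub]
    fin_cases i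
    · simp [h0, pd_quad_zero]
    · simp [h1, pd_quad_one]
  have := eq_const_of_pd_eq_zero (hf.sub hq) key p
  simp [quad] at this ⊢
  linarith

theorem stmt9 (T1 : ℝ) (hT : T1 ≠ 0)
    (v : Fin 2 → (Fin 2 → ℝ) → ℝ)
    (hv : ∀ i : Fin 2, ContDiff ℝ (⊤ : ℕ∞) (v i)) :
    IsAffineKilling Set.univ
      (fun i j k => fun _ : Fin 2 → ℝ =>
        ![![![(0 : ℝ), 0], ![T1, 0]], ![![-T1, 0], ![1, 0]]] i j k) v
    ↔ ∃ a b c d : ℝ, ∀ p : Fin 2 → ℝ,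
        v 0 p = a + c * (p 0 + (p 1) ^ 2 / 2) + d * p 1
        ∧ v 1 p = b := by
  constructor
  · intro h
    have hd : ∀ i, Differentiable ℝ (v i) := fun i => (hv i).differentiable (by simp)
    have hd' : ∀ i j, Differentiable ℝ (fun p => pd (v i) j p) :=
      fun i j => (pd_contDiff (hv i) j).differentiable (by simp)
    have hw0 : ∀ p, pd (v 1) 0 p = 0 := by
      intro p
      have e1 := h 0 1 1 p trivial
      have e2 := h 1 0 1 p trivial
      have hs := pd_comm (hv 1) 0 1 p
      simp [killingOp, pd_const] at e1 e2
      have : T1 * pd (v 1) 0 p = 0 := by linarith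
      exact (mul_eq_zero.1 this).resolve_left hT
    have hw1 : ∀ p, pd (v 1) 1 p = 0 ∧ pd (fun q => pd (v 0) 0 q) 1 p = 0 := by
      intro p
      have e1 := h 0 1 0 p trivial
      have e2 := h 1 0 0 p trivial
      have hs := pd_comm (hv 0) 0 1 p
      simp [killingOp, pd_const, hw0] at e1 e2
      have h1 : T1 * pd (v 1) 1 p = 0 := by linarith
      exact ⟨(mul_eq_zero.1 h1).resolve_left hT, by linarith⟩
    have hu00 : ∀ p, pd (fun q => pd (v 0) 0 q) 0 p = 0 := by
      intro p
      have e := h 0 0 0 p trivial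
      simpa [killingOp, pd_const, hw0] using e
    have hu0 : ∀ p, pd (v 0) 0 p = pd (v 0) 0 0 :=
      eq_const_of_pd_eq_zero (hd' 0 0) (Fin.forall_fin_two.2 ⟨hu00, fun p => (hw1 p).2⟩)
    have hu11 : ∀ p, pd (fun q => pd (v 0) 1 q) 1 p = pd (v 0) 0 0 := by
      intro p
      have e := h 1 1 0 p trivial
      simp [killingOp, pd_const, (hw1 p).1] at e
      linarith [hu0 p]
    have hu1 := eq_quad_of_pd_eq (hd' 0 1) 0 (pd (v 0) 0 0) 0
      (fun p => (pd_comm (hv 0) 0 1 p).trans (hw1 p).2) (fun p => by simp [hu11 p])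
    have hu := eq_quad_of_pd_eq (hd 0) (pd (v 0) 0 0) (pd (v 0) 1 0) (pd (v 0) 0 0 / 2) hu0
      (fun p => by rw [hu1 p, quad]; ring)
    refine ⟨v 0 0, v 1 0, pd (v 0) 0 0, pd (v 0) 1 0, fun p => ⟨?_, ?_⟩⟩
    · rw [hu p, quad]
      ring
    · exact eq_const_of_pd_eq_zero (hd 1)
        (Fin.forall_fin_two.2 ⟨hw0, fun p => (hw1 p).1⟩) p
  · rintro ⟨a, b, c, d, h⟩
    have h0 : v 0 = quad a c d (c / 2) := by
      funext p
      rw [(h p).1, quad]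
      ring
    have h1 : v 1 = fun _ => b := funext fun p => (h p).2
    have hp : (fun q : Fin 2 → ℝ => d + 2 * (c / 2) * q 1) = quad d 0 c 0 := by
      funext q
      rw [quad]
      ring
    refine Fin.forall_fin_two.2 ⟨Fin.forall_fin_two.2 ⟨?_, ?_⟩, Fin.forall_fin_two.2 ⟨?_, ?_⟩⟩ <;>
      refine Fin.forall_fin_two.2 ⟨fun p _ => ?_, fun p _ => ?_⟩ <;>
      simp only [killingOp, Fin.sum_univ_two, h0, h1, pd_quad_zero, pd_quad_one, hp, pd_const] <;>
      simp
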